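/- In the bigraded setup below with k = 1 (so S = ℂ[z_1,…,z_{N+2}, w]), let f ∈ ℂ[z_1,…,z_{N+2}] be a nonzero homogeneous polynomial of degree d with 1 ≤ d ≤ N, and set F = w·f. Then dim_ℂ R_{1,−(N+2−d)} = C(2d−1, N+1). -/

import Mathlib

open MvPolynomial

noncomputable section

/-- The polynomial ring `S = ℂ[z_1,…,z_{N+k+1}, w_1,…,w_k]`. -/
abbrev SRing (N k : ℕ) : Type := MvPolynomial (Fin (N + k + 1) ⊕ Fin k) ℂ

/-- The bigrading on `S`: `deg z_s = (0,1)` and `deg w_j = (1, -d_j)`. -/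
def wt (N k : ℕ) (d : Fin k → ℕ) : Fin (N + k + 1) ⊕ Fin k → ℤ × ℤ :=
  Sum.elim (fun _ => ((0 : ℤ), (1 : ℤ))) (fun j => ((1 : ℤ), -(d j : ℤ)))

/-- `F = w_1 f_1 + ⋯ + w_k f_k ∈ S`. -/
def bigF (N k : ℕ) (f : Fin k → MvPolynomial (Fin (N + k + 1)) ℂ) : SRing N k :=
  ∑ j : Fin k, X (Sum.inr j) * rename Sum.inl (f j)

/-- The ideal `J(F)` generated by all the partial derivatives of `F`. -/
def Jfull (N k : ℕ) (f : Fin k → MvPolynomial (Fin (N + k + 1)) ℂ) : Ideal (SRing N k) :=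
  Ideal.span (Set.range fun v : Fin (N + k + 1) ⊕ Fin k => pderiv v (bigF N k f))

/-- The ideal `J'(F)` generated by `∂F/∂w_1, …, ∂F/∂w_k` alone. -/
def Jprime (N k : ℕ) (f : Fin k → MvPolynomial (Fin (N + k + 1)) ℂ) : Ideal (SRing N k) :=
  Ideal.span (Set.range fun j : Fin k => pderiv (Sum.inr j) (bigF N k f))

lemma Jprime_le_Jfull (N k : ℕ) (f : Fin k → MvPolynomial (Fin (N + k + 1)) ℂ) :
    Jprime N k f ≤ Jfull N k f :=
  Ideal.span_mono (by rintro x ⟨j, rfl⟩; exact ⟨Sum.inr j, rfl⟩)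

/-- The bidegree-`(p,q)` component of `S`. -/
def Scomp (N k : ℕ) (d : Fin k → ℕ) (p q : ℤ) : Submodule ℂ (SRing N k) :=
  weightedHomogeneousSubmodule ℂ (wt N k d) (p, q)

/-- The bidegree-`(p,q)` component of `R = S/J(F)`. -/
def Rcomp (N k : ℕ) (d : Fin k → ℕ) (f : Fin k → MvPolynomial (Fin (N + k + 1)) ℂ)
    (p q : ℤ) : Submodule ℂ (SRing N k ⧸ Jfull N k f) :=
  Submodule.map (Ideal.Quotient.mkₐ ℂ (Jfull N k f)).toLinearMap (Scomp N k d p q)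

/-- The bidegree-`(p,q)` component of `R' = S/J'(F)`. -/
def R'comp (N k : ℕ) (d : Fin k → ℕ) (f : Fin k → MvPolynomial (Fin (N + k + 1)) ℂ)
    (p q : ℤ) : Submodule ℂ (SRing N k ⧸ Jprime N k f) :=
  Submodule.map (Ideal.Quotient.mkₐ ℂ (Jprime N k f)).toLinearMap (Scomp N k d p q)

namespace MvPolynomial

lemma IsWeightedHomogeneous.rename {R M σ τ : Type*} [CommSemiring R] [AddCommMonoid M]
    {w : τ → M} {g : σ → τ} {p : MvPolynomial σ R} {n : M}
    (hp : p.IsWeightedHomogeneous (w ∘ g) n) : (rename g p).IsWeightedHomogeneous w n := by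
  intro m hm
  obtain ⟨u, rfl, hu⟩ := coeff_rename_ne_zero g p m hm
  rw [← hp hu]
  exact Finsupp.linearCombination_mapDomain ℕ g u

lemma IsWeightedHomogeneous.mem_restrictSupport {R σ : Type*} [CommSemiring R] {w : σ → ℕ}
    {p : MvPolynomial σ R} {k n : ℕ} (hp : p.IsWeightedHomogeneous w n) (hkn : k ≤ n) :
    p ∈ restrictSupport R {m | k ≤ Finsupp.weight w m} :=
  fun _ hm => hkn.trans (hp (mem_support_iff.mp hm)).ge

end MvPolynomial

lemma Finsupp.isUpperSet_le_weight {σ : Type*} (w : σ → ℕ) (k : ℕ) :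
    IsUpperSet {m : σ →₀ ℕ | k ≤ Finsupp.weight w m} := by
  intro a b hab ha
  obtain ⟨c, rfl⟩ := exists_add_of_le hab
  simp only [Set.mem_ofPred_eq, map_add] at ha ⊢
  omega

/-- The weight on the variables of `S` for which the `z_s` have degree `1` and the `w_j` have
degree `0`. -/
def zWeight (N k : ℕ) : Fin (N + k + 1) ⊕ Fin k → ℕ :=
  Sum.elim (fun _ => 1) (fun _ => 0)

lemma isWeightedHomogeneous_bigF (N k : ℕ) (f : Fin k → MvPolynomial (Fin (N + k + 1)) ℂ)
    (d : ℕ) (hf : ∀ j, (f j).IsHomogeneous d) :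
    (bigF N k f).IsWeightedHomogeneous (zWeight N k) d := by
  refine IsWeightedHomogeneous.sum _ _ _ fun j _ => ?_
  have h := (isWeightedHomogeneous_X ℂ (zWeight N k) (Sum.inr j)).mul
    (IsWeightedHomogeneous.rename (w := zWeight N k) (g := Sum.inl) (hf j))
  simpa [zWeight] using h

/-- Every monomial of an element of `J(F)` has degree at least `d - 1` in the `z_s`. -/
lemma Jfull_le_restrictSupportIdeal (N k : ℕ) (f : Fin k → MvPolynomial (Fin (N + k + 1)) ℂ)
    (d : ℕ) (hd : 1 ≤ d) (hf : ∀ j, (f j).IsHomogeneous d) :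
    Jfull N k f ≤
      restrictSupportIdeal ℂ _ (Finsupp.isUpperSet_le_weight (zWeight N k) (d - 1)) := by
  refine Ideal.span_le.mpr ?_
  rintro _ ⟨v | v, rfl⟩
  · exact ((isWeightedHomogeneous_bigF N k f d hf).pderiv (n' := d - 1)
      (by simp only [zWeight, Sum.elim_inl]; omega)).mem_restrictSupport le_rfl
  · exact ((isWeightedHomogeneous_bigF N k f d hf).pderiv (n' := d)
      (by simp [zWeight])).mem_restrictSupport (Nat.sub_le d 1)

lemma weight_wt (N k : ℕ) (d : Fin k → ℕ) (m : Fin (N + k + 1) ⊕ Fin k →₀ ℕ) :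
    Finsupp.weight (wt N k d) m = (((∑ j, m (Sum.inr j) : ℕ) : ℤ),
      (Finsupp.weight (zWeight N k) m : ℤ) - ∑ j, (m (Sum.inr j) : ℤ) * d j) := by
  simp [Finsupp.weight_eq_sum, wt, zWeight, Prod.ext_iff, Prod.fst_sum, Prod.snd_sum,
    sub_eq_add_neg]

lemma weight_wt_one_eq_iff (N d : ℕ) (q : ℤ) (m : Fin (N + 1 + 1) ⊕ Fin 1 →₀ ℕ) :
    Finsupp.weight (wt N 1 fun _ => d) m = (1, q) ↔
      m (Sum.inr 0) = 1 ∧ (Finsupp.weight (zWeight N 1) m : ℤ) = q + d := by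
  rw [weight_wt]
  simp only [Fin.sum_univ_one, Prod.mk.injEq, Nat.cast_eq_one]
  refine and_congr_right fun h => ?_
  rw [h]
  constructor <;> intro <;> push_cast at * <;> linarith

lemma finrank_Scomp (N k : ℕ) (d : Fin k → ℕ) (p q : ℤ) :
    Module.finrank ℂ (Scomp N k d p q) =
      Nat.card {m : Fin (N + k + 1) ⊕ Fin k →₀ ℕ | Finsupp.weight (wt N k d) m = (p, q)} := by
  rw [Scomp, weightedHomogeneousSubmodule_eq_finsupp_supported]
  exact Module.finrank_eq_nat_card_basis (basisRestrictSupport ℂ _)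

lemma finrank_Rcomp_eq_finrank_Scomp (N k : ℕ) (d : Fin k → ℕ)
    (f : Fin k → MvPolynomial (Fin (N + k + 1)) ℂ) (p q : ℤ)
    (h : Disjoint (Scomp N k d p q) ((Jfull N k f).restrictScalars ℂ)) :
    Module.finrank ℂ (Rcomp N k d f p q) = Module.finrank ℂ (Scomp N k d p q) := by
  rw [Rcomp, ← LinearMap.range_domRestrict]
  refine LinearMap.finrank_range_of_inj ?_
  rw [← LinearMap.ker_eq_bot, LinearMap.ker_eq_bot']
  rintro ⟨x, hx⟩ hx0
  exact Subtype.ext (Submodule.disjoint_def.mp h x hx (Ideal.Quotient.eq_zero_iff_mem.mp hx0))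

/-- The monomials `w · z^a` with `|a| = e`, counted by stars and bars. -/
lemma card_monomials (N e : ℕ) :
    Nat.card {m : Fin (N + 1 + 1) ⊕ Fin 1 →₀ ℕ |
      m (Sum.inr 0) = 1 ∧ Finsupp.weight (zWeight N 1) m = e} = (N + 1 + e).choose e := by
  have E : {m : Fin (N + 1 + 1) ⊕ Fin 1 →₀ ℕ |
      m (Sum.inr 0) = 1 ∧ Finsupp.weight (zWeight N 1) m = e} ≃
        {P : Fin (N + 1 + 1) → ℕ // ∑ i, P i = e} :=
    { toFun m := ⟨fun i => m.1 (Sum.inl i), by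
        simpa [Finsupp.weight_eq_sum, zWeight] using m.2.2⟩
      invFun P := ⟨Finsupp.equivFunOnFinite.symm (Sum.elim P.1 fun _ => 1), by
        simpa [Finsupp.weight_eq_sum, zWeight] using P.2⟩
      left_inv m := by
        ext (i | i)
        · rfl
        · rw [Subsingleton.elim i 0, m.2.1]
          rfl
      right_inv P := rfl }
  rw [Nat.card_congr (E.trans (Sym.equivNatSumOfFintype _ e).symm), Nat.card_eq_fintype_card,
    Sym.card_sym_eq_choose, Fintype.card_fin]
  congr 1
  omega

/-- **Corollary 3.6, first case.** For `k = 1`, a nonzero homogeneous `f` of degree `d`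
with `1 ≤ d ≤ N` and `F = w·f`, one has `dim_ℂ R_{1,-(N+2-d)} = C(2d-1, N+1)`. -/
theorem finrank_Rcomp_hypersurface (N : ℕ) (hN : 1 ≤ N) (dd : ℕ) (hd : 1 ≤ dd)
    (hdN : dd ≤ N) (f0 : MvPolynomial (Fin (N + 1 + 1)) ℂ) (hf0 : f0 ≠ 0)
    (hfhom : f0.IsHomogeneous dd) :
    Module.finrank ℂ
        (Rcomp N 1 (fun _ => dd) (fun _ => f0) 1 (-((N + 2 - dd : ℕ) : ℤ)))
      = Nat.choose (2 * dd - 1) (N + 1) := by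
  rw [finrank_Rcomp_eq_finrank_Scomp, finrank_Scomp]
  · simp only [weight_wt_one_eq_iff]
    obtain he | he := le_or_gt (N + 2) (2 * dd)
    · have hq : -((N + 2 - dd : ℕ) : ℤ) + dd = (2 * dd - (N + 2) : ℕ) := by omega
      simp only [hq, Nat.cast_inj]
      rw [card_monomials, ← Nat.choose_symm_add]
      congr 1
      omega
    · rw [Nat.choose_eq_zero_of_lt (by omega), Nat.card_eq_zero]
      refine Or.inl ⟨?_⟩
      rintro ⟨m, -, hm⟩
      omega
  · refine Submodule.disjoint_def.mpr fun x hx hxJ => ?_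
    by_contra hx0
    obtain ⟨m, hm⟩ := ne_zero_iff.mp hx0
    have hlow := Jfull_le_restrictSupportIdeal N 1 _ dd hd (fun _ => hfhom) hxJ
      (mem_support_iff.mpr hm)
    have hdeg := ((weight_wt_one_eq_iff N dd _ m).mp (hx hm)).2
    simp only [Set.mem_ofPred_eq] at hlow
    omega
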